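/- Let A_n = (1/2π)∫_{π/2}^{2π/3} j(e^{iθ})^n dθ and B_n = −c_n(0), where c_n(0) is the coefficient of q^0 in j^n (equivalently, −B_n = ∫_{π/3}^{2π/3} sin(θ) j(e^{iθ})^n dθ). Then lim_{n→∞} A_n/(−B_n) = 1/(4π). -/

import Mathlib

open Complex Polynomial Real MeasureTheory Filter Topology

noncomputable section

/-- `q = e^{2πiz}`. -/
def qexp (z : ℂ) : ℂ := Complex.exp (2 * Real.pi * Complex.I * z)

/-- The normalized Eisenstein series `E_k(z) = (1/2) ∑_{gcd(c,d)=1} (cz+d)^{-k}`,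
with the convention `E_0 = 1`. -/
def Eis (k : ℕ) (z : ℂ) : ℂ :=
  if k = 0 then 1
  else (1 / 2) * ∑' p : ℤ × ℤ, if Int.gcd p.1 p.2 = 1 then 1 / ((p.1 : ℂ) * z + (p.2 : ℂ)) ^ k else 0

/-- The modular discriminant `Δ(z) = q ∏_{n ≥ 1} (1 - q^n)^24`, `q = e^{2πiz}`. -/
def Disc (z : ℂ) : ℂ := qexp z * ∏' n : ℕ, (1 - qexp z ^ (n + 1)) ^ 24

/-- The modular `j`-invariant `j = E₄³ / Δ`. -/
def jinv (z : ℂ) : ℂ := Eis 4 z ^ 3 / Disc z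

/-- The coefficient of `q^d` in the Fourier/`q`-expansion of a `1`-periodic function
holomorphic on the upper half-plane, computed at height `1`. -/
def qCoeff (f : ℂ → ℂ) (d : ℤ) : ℂ :=
  ∫ x in (0:ℝ)..1,
    f (x + Complex.I) * Complex.exp (-(2 * Real.pi * Complex.I * d * (x + Complex.I)))

/-- `c_N(d)`: the coefficient of `q^d` in the Laurent expansion of `j^N`. -/
def cj (N : ℕ) (d : ℤ) : ℂ := qCoeff (fun z => jinv z ^ N) d

/-- `A_n = (1/2π) ∫_{π/2}^{2π/3} j(e^{iθ})^n dθ`. -/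
def Acoef (n : ℕ) : ℂ :=
  (1 / (2 * Real.pi)) *
    ∫ θ in (Real.pi / 2)..(2 * Real.pi / 3), jinv (Complex.exp (θ * Complex.I)) ^ n

/-- `B_n = -c_n(0)`, where `c_n(0)` is the coefficient of `q^0` in `j^n`. -/
def Bcoef (n : ℕ) : ℂ := - cj n 0

/-- `C_n(k') = 0` for `k' ∈ {0,4,8}` and `C_n(k') = -1728^n/2` for `k' ∈ {6,10,14}`. -/
def Ccoef (n k' : ℕ) : ℂ := if k' = 6 ∨ k' = 10 ∨ k' = 14 then -(1728 : ℂ) ^ n / 2 else 0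

/-- Real-valued version of `A_n` (recall `j` is real on the arc). -/
def AcoefR (n : ℕ) : ℝ :=
  (1 / (2 * Real.pi)) *
    ∫ θ in (Real.pi / 2)..(2 * Real.pi / 3), (jinv (Complex.exp (θ * Complex.I)) ^ n).re

/-- Real-valued version of `B_n = -c_n(0)` (recall `c_n(0)` is an integer). -/
def BcoefR (n : ℕ) : ℝ := - (cj n 0).re

/-- Real-valued version of `C_n(k')`. -/
def CcoefR (n k' : ℕ) : ℝ := if k' = 6 ∨ k' = 10 ∨ k' = 14 then -(1728 : ℝ) ^ n / 2 else 0

/-- `f` is the `m`-th element `f_{k,m} = q^m + O(q^{ℓ+1})` of the Miller basis of `M_k`,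
`k = 12ℓ + k'`: it is holomorphic on the upper half-plane, weight-`k` modular for
`SL₂(ℤ)`, and has a convergent `q`-expansion whose coefficients in degrees `≤ ℓ`
are `δ_{d,m}`. -/
def IsMillerForm (ℓ k' m : ℕ) (f : ℂ → ℂ) : Prop :=
  (∀ z : ℂ, 0 < z.im → DifferentiableAt ℂ f z) ∧
  (∀ z : ℂ, 0 < z.im → f (z + 1) = f z) ∧
  (∀ z : ℂ, 0 < z.im → f (-1 / z) = z ^ (12 * ℓ + k') * f z) ∧
  (∃ a : ℕ → ℂ,
    (∀ z : ℂ, 0 < z.im →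
      Summable (fun n : ℕ => a n * qexp z ^ n) ∧ f z = ∑' n : ℕ, a n * qexp z ^ n) ∧
    (∀ d : ℕ, d ≤ ℓ → a d = if d = m then 1 else 0))

/-- `F` is the Faber polynomial of `f = f_{k,m}`, `k = 12ℓ + k'`: the monic polynomial
of degree `ℓ - m` with `f = Δ^ℓ ⬝ E_{k'} ⬝ F(j)`. -/
def IsFaber (ℓ k' m : ℕ) (f : ℂ → ℂ) (F : Polynomial ℂ) : Prop :=
  F.Monic ∧ F.natDegree = ℓ - m ∧
  ∀ z : ℂ, 0 < z.im → f z = Disc z ^ ℓ * Eis k' z * F.eval (jinv z)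

/-- The sum of the `n`-th powers of the zeros of `F`, counted with multiplicity. -/
def powerSumRoots (F : Polynomial ℂ) (n : ℕ) : ℂ := (F.roots.map (fun x => x ^ n)).sum

/-- The (finite) solutions of `d_1 + 2 d_2 + ⋯ + n d_n = n` in nonnegative integers,
indexed by `Fin n` (so index `t : Fin n` stands for `d_{t+1}`).  Note any solution
automatically has `d_t ≤ n`. -/
def sols (n : ℕ) : Finset (Fin n → ℕ) :=
  (Fintype.piFinset fun _ : Fin n => Finset.range (n + 1)).filter
    (fun d => ∑ t : Fin n, ((t : ℕ) + 1) * d t = n)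

open UpperHalfPlane ModularForm MatrixGroups in
lemma Eis_eq_E {k : ℕ} (hk : 3 ≤ k) (z : ℍ) : Eis k (z : ℂ) = ModularForm.E hk z := by
  have h1 : ModularForm.E hk z = (1 / 2 : ℂ) * eisensteinSeries (0 : Fin 2 → ZMod 1) k z := rfl
  rw [h1, Eis, if_neg (by omega), eisensteinSeries]
  congr 1
  rw [tsum_subtype (EisensteinSeries.gammaSet 1 1 0) (fun v => EisensteinSeries.eisSummand k v z)]
  rw [← (finTwoArrowEquiv ℤ).symm.tsum_eq]
  refine tsum_congr fun p => ?_
  simp only [Set.indicator, EisensteinSeries.gammaSet_one_mem_iff, EisensteinSeries.eisSummand]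
  simp [zpow_neg]

open UpperHalfPlane in
lemma Disc_eq (z : ℍ) : Disc (z : ℂ) = ModularForm.discriminant z := by
  rw [ModularForm.discriminant_eq_q_prod, Disc]
  simp [qexp, Function.Periodic.qParam, ModularForm.eta_q_eq_pow]

open UpperHalfPlane ModularForm MatrixGroups in
lemma jinv_coe (z : ℍ) : jinv (z : ℂ) = E₄ z ^ 3 / discriminant z := by
  rw [jinv, Disc_eq, Eis_eq_E (by norm_num : 3 ≤ 4)]

open UpperHalfPlane ModularForm MatrixGroups in
lemma E_T {k : ℕ} (hk : 3 ≤ k) (z : ℍ) : E hk ((1 : ℝ) +ᵥ z) = E hk z :=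
  SlashInvariantForm.vAdd_apply_of_mem_strictPeriods _ _ (by simp)

open UpperHalfPlane ModularForm MatrixGroups in
lemma E_S {k : ℕ} (hk : 3 ≤ k) (z : ℍ) :
    E hk (.mk _ z.im_inv_neg_coe_pos) = (z : ℂ) ^ k * E hk z := by
  have h := congr_fun (SlashInvariantForm.slash_action_eqn (Γ := 𝒮ℒ) (k := (k : ℤ)) (E hk)
    (ModularGroup.S : GL (Fin 2) ℝ) ⟨ModularGroup.S, rfl⟩) z
  rw [← ModularForm.SL_slash] at h
  rw [SlashInvariantForm.slash_S_apply] at h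
  rw [← h]
  have : (z : ℂ) ≠ 0 := z.ne_zero
  simp [zpow_neg]
  field_simp

open UpperHalfPlane ModularForm MatrixGroups in
lemma disc_eq46 (z : ℍ) : discriminant z = (E₄ z ^ 3 - E₆ z ^ 2) / 1728 :=
  discriminant_eq_E₄_cube_sub_E₆_sq z

open UpperHalfPlane ModularForm MatrixGroups in
lemma jinv_T {z : ℂ} (hz : 0 < z.im) : jinv (z + 1) = jinv z := by
  lift z to ℍ using hz
  have : (z : ℂ) + 1 = ((1 : ℝ) +ᵥ z : ℍ) := by simp [add_comm]
  rw [this, jinv_coe, jinv_coe, disc_eq46, disc_eq46, E_T, E_T]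

open UpperHalfPlane ModularForm MatrixGroups in
lemma jinv_S {z : ℂ} (hz : 0 < z.im) : jinv ((-z)⁻¹) = jinv z := by
  lift z to ℍ using hz
  have : (-(z : ℂ))⁻¹ = (UpperHalfPlane.mk _ z.im_inv_neg_coe_pos : ℍ) := by simp
  have h0 : (z : ℂ) ≠ 0 := z.ne_zero
  rw [this, jinv_coe, jinv_coe, disc_eq46, disc_eq46, E_S, E_S]
  have h : ∀ a b w : ℂ, w ≠ 0 → (w ^ 4 * a) ^ 3 / (((w ^ 4 * a) ^ 3 - (w ^ 6 * b) ^ 2) / 1728) =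
      a ^ 3 / ((a ^ 3 - b ^ 2) / 1728) := by
    intro a b w hw
    rw [show ((w ^ 4 * a) ^ 3 - (w ^ 6 * b) ^ 2) / 1728 = w ^ 12 * ((a ^ 3 - b ^ 2) / 1728) by ring,
      show (w ^ 4 * a) ^ 3 = w ^ 12 * a ^ 3 by ring, mul_div_mul_left _ _ (pow_ne_zero _ hw)]
  exact h _ _ _ h0

open UpperHalfPlane ModularForm MatrixGroups in
lemma E_diff {k : ℕ} (hk : 3 ≤ k) : DifferentiableOn ℂ (Eis k) {z | 0 < z.im} := by
  have h := UpperHalfPlane.mdifferentiable_iff.mp (ModularFormClass.holo (E hk))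
  refine h.congr fun z hz => ?_
  lift z to ℍ using hz
  simp [Eis_eq_E hk]

open UpperHalfPlane ModularForm MatrixGroups in
lemma Disc_eq46 {z : ℂ} (hz : 0 < z.im) : Disc z = (Eis 4 z ^ 3 - Eis 6 z ^ 2) / 1728 := by
  lift z to ℍ using hz
  rw [Disc_eq, disc_eq46, Eis_eq_E (by norm_num : 3 ≤ 4), Eis_eq_E (by norm_num : 3 ≤ 6)]

open UpperHalfPlane ModularForm MatrixGroups in
lemma Disc_ne {z : ℂ} (hz : 0 < z.im) : Disc z ≠ 0 := by
  lift z to ℍ using hz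
  rw [Disc_eq]
  exact discriminant_ne_zero z

lemma jinv_diff : DifferentiableOn ℂ jinv {z | 0 < z.im} := by
  refine DifferentiableOn.fun_div ((E_diff (by norm_num)).pow 3) ?_ fun z hz => Disc_ne hz
  refine DifferentiableOn.congr (f := fun z => (Eis 4 z ^ 3 - Eis 6 z ^ 2) / 1728) ?_
    fun z hz => Disc_eq46 hz
  have h4 := E_diff (k := 4) (by norm_num)
  have h6 := E_diff (k := 6) (by norm_num)
  fun_prop

open UpperHalfPlane ModularForm MatrixGroups in
lemma Eis_T {k : ℕ} (hk : 3 ≤ k) {z : ℂ} (hz : 0 < z.im) : Eis k (z + 1) = Eis k z := by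
  lift z to ℍ using hz
  have : (z : ℂ) + 1 = ((1 : ℝ) +ᵥ z : ℍ) := by simp [add_comm]
  rw [this, Eis_eq_E hk, Eis_eq_E hk, E_T]

open UpperHalfPlane ModularForm MatrixGroups in
lemma Eis_S {k : ℕ} (hk : 3 ≤ k) {z : ℂ} (hz : 0 < z.im) :
    Eis k ((-z)⁻¹) = z ^ k * Eis k z := by
  lift z to ℍ using hz
  have : (-(z : ℂ))⁻¹ = (UpperHalfPlane.mk _ z.im_inv_neg_coe_pos : ℍ) := by simp
  rw [this, Eis_eq_E hk, Eis_eq_E hk, E_S]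

open UpperHalfPlane in
lemma Eis_hasSum {k : ℕ} (hk : 3 ≤ k) (hk2 : Even k) {z : ℂ} (hz : 0 < z.im) :
    Summable (fun n : ℕ => (ArithmeticFunction.sigma (k - 1) n : ℂ) * qexp z ^ n) ∧
    Eis k z = 1 - ((2 * k / _root_.bernoulli k : ℚ) : ℂ) *
      ∑' n : ℕ, (ArithmeticFunction.sigma (k - 1) n : ℂ) * qexp z ^ n := by
  lift z to ℍ using hz
  refine ⟨EisensteinSeries.summable_sigma_mul_cexp_pow (by omega) z, ?_⟩
  rw [Eis_eq_E hk, EisensteinSeries.q_expansion_bernoulli hk hk2]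
  push_cast
  congr 2
  rw [← tsum_pnat_eq_tsum_of_eq_zero (by simp)]
  simp [qexp]
lemma qexp_conj (z : ℂ) : qexp (-(starRingEnd ℂ) z) = (starRingEnd ℂ) (qexp z) := by
  rw [qexp, qexp, ← Complex.exp_conj]
  congr 1
  simp [map_ofNat]

lemma Eis_conj {k : ℕ} (hk : 3 ≤ k) (hk2 : Even k) {z : ℂ} (hz : 0 < z.im) :
    Eis k (-(starRingEnd ℂ) z) = (starRingEnd ℂ) (Eis k z) := by
  have hzc : 0 < (-(starRingEnd ℂ) z).im := by simpa using hz
  rw [(Eis_hasSum hk hk2 hz).2, (Eis_hasSum hk hk2 hzc).2, qexp_conj]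
  rw [map_sub, map_mul, Complex.conj_tsum]
  simp [map_ofNat]

lemma jinv_conj {z : ℂ} (hz : 0 < z.im) :
    jinv (-(starRingEnd ℂ) z) = (starRingEnd ℂ) (jinv z) := by
  have hzc : 0 < (-(starRingEnd ℂ) z).im := by simpa using hz
  rw [jinv, jinv, Disc_eq46 hz, Disc_eq46 hzc, Eis_conj (by norm_num) (by decide) hz,
    Eis_conj (by norm_num) (by decide) hz]
  simp [map_ofNat]

lemma abs_im_pow_le (q : ℂ) (n : ℕ) : |(q ^ (n + 1)).im| ≤ (n + 1) * ‖q‖ ^ n * |q.im| := by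
  induction n with
  | zero => simp
  | succ n ih =>
    rw [pow_succ, Complex.mul_im]
    have h1 : |(q ^ (n + 1)).re| ≤ ‖q‖ ^ (n + 1) := by
      rw [← norm_pow]; exact Complex.abs_re_le_norm _
    have h2 : |q.re| ≤ ‖q‖ := Complex.abs_re_le_norm _
    calc _ ≤ |(q ^ (n + 1)).re| * |q.im| + |(q ^ (n + 1)).im| * |q.re| := by
          rw [← abs_mul, ← abs_mul]; exact abs_add_le _ _
      _ ≤ ‖q‖ ^ (n + 1) * |q.im| + ((n + 1) * ‖q‖ ^ n * |q.im|) * ‖q‖ := by gcongr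
      _ = _ := by push_cast; ring

lemma pow7_le (n : ℕ) : ((n : ℝ) + 2) ^ 7 ≤ 128 * 20 ^ n := by
  induction n with
  | zero => norm_num
  | succ n ih =>
    have h : (2 * ((n : ℝ) + 3)) ^ 7 ≤ (3 * ((n : ℝ) + 2)) ^ 7 := by
      gcongr ?_ ^ 7
      have : (0 : ℝ) ≤ n := Nat.cast_nonneg n
      linarith
    have h3 : (0 : ℝ) ≤ ((n : ℝ) + 2) ^ 7 := by positivity
    rw [mul_pow, mul_pow] at h
    push_cast
    rw [pow_succ (20 : ℝ), show (n : ℝ) + 1 + 2 = n + 3 by ring]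
    norm_num at h
    linarith

lemma im_tsum_ne {q : ℂ} (hq : ‖q‖ ≤ 1 / 200) (hi : q.im ≠ 0) {a : ℕ → ℕ} (h0 : a 0 = 0)
    (h1 : a 1 = 1) (ha : ∀ n, a n ≤ n ^ 6) (hs : Summable fun n : ℕ => (a n : ℂ) * q ^ n) :
    (∑' n : ℕ, (a n : ℂ) * q ^ n).im ≠ 0 := by
  have hs2 : Summable fun n : ℕ => (a (n + 2) : ℂ) * q ^ (n + 2) :=
    (summable_nat_add_iff (f := fun n : ℕ => (a n : ℂ) * q ^ n) 2).2 hs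
  rw [← hs.sum_add_tsum_nat_add 2]
  simp only [Finset.sum_range_succ, Finset.sum_range_zero, h0, h1]
  rw [Complex.add_im, Complex.im_tsum hs2]
  have hb : ∀ n : ℕ, ‖((a (n + 2) : ℂ) * q ^ (n + 2)).im‖ ≤ (128 / 200 * |q.im|) * (1 / 10) ^ n := by
    intro n
    have e : ((a (n + 2) : ℂ) * q ^ (n + 2)).im = (a (n + 2) : ℝ) * (q ^ (n + 2)).im := by
      rw [← Complex.ofReal_natCast, Complex.im_ofReal_mul]
    rw [e, Real.norm_eq_abs, abs_mul, Nat.abs_cast]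
    have h2 := abs_im_pow_le q (n + 1)
    have h3 : (a (n + 2) : ℝ) ≤ ((n : ℝ) + 2) ^ 6 := by exact_mod_cast ha (n + 2)
    calc _ ≤ ((n : ℝ) + 2) ^ 6 * ((((n + 1 : ℕ) : ℝ) + 1) * (1 / 200) ^ (n + 1) * |q.im|) := by
          gcongr
          exact h2.trans (by gcongr)
      _ = ((n : ℝ) + 2) ^ 7 * ((1 / 200) ^ (n + 1) * |q.im|) := by push_cast; ring
      _ ≤ (128 * 20 ^ n) * ((1 / 200) ^ (n + 1) * |q.im|) := by gcongr; exact pow7_le n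
      _ = _ := by
        rw [show (1 / 10 : ℝ) = 20 * (1 / 200) by norm_num, mul_pow]; ring
  have hg := (hasSum_geometric_of_lt_one (r := (1 / 10 : ℝ)) (by norm_num) (by norm_num)).mul_left
    (128 / 200 * |q.im|)
  have hT := tsum_of_norm_bounded hg hb
  have hpos : 0 < |q.im| := abs_pos.2 hi
  intro h
  simp at h
  have : ‖∑' n : ℕ, ((a (n + 2) : ℂ) * q ^ (n + 2)).im‖ = |q.im| := by
    have : ∑' n : ℕ, ((a (n + 2) : ℂ) * q ^ (n + 2)).im = - q.im := by simp; linarith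
    rw [this, norm_neg, Real.norm_eq_abs]
  rw [this] at hT
  norm_num at hT
  linarith

lemma Eis_ne {k : ℕ} (hk : 3 ≤ k) (hk6 : k ≤ 6) (hk2 : Even k) {z : ℂ} (hz : 0 < z.im)
    (hb : (2 * k / _root_.bernoulli k : ℚ) ≠ 0)
    (hq : ‖qexp z‖ ≤ 1 / 200) (hi : (qexp z).im ≠ 0) : Eis k z ≠ 0 := by
  obtain ⟨hs, he⟩ := Eis_hasSum hk hk2 hz
  have := im_tsum_ne hq hi (a := fun n => ArithmeticFunction.sigma (k - 1) n) (by simp) (by simp)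
    (fun n => by
      rcases Nat.eq_zero_or_pos n with rfl | hn
      · simp
      · exact (ArithmeticFunction.sigma_le_pow_succ (k - 1) n).trans
          (Nat.pow_le_pow_right hn (by omega))) hs
  intro h
  have him := congrArg Complex.im (he.symm.trans h)
  rw [← Complex.ofReal_ratCast] at him
  simp only [Complex.sub_im, Complex.im_ofReal_mul, Complex.one_im, Complex.zero_im, zero_sub, neg_eq_zero, mul_eq_zero] at him
  rcases him with h | h
  · exact hb (by exact_mod_cast h)
  · exact this h
lemma arc_im (θ : ℝ) : (Complex.exp (θ * Complex.I)).im = Real.sin θ := Complex.exp_ofReal_mul_I_im θ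

lemma arc_re (θ : ℝ) : (Complex.exp (θ * Complex.I)).re = Real.cos θ := Complex.exp_ofReal_mul_I_re θ

lemma arc_neg_inv (θ : ℝ) :
    (-Complex.exp (θ * Complex.I))⁻¹ = -(starRingEnd ℂ) (Complex.exp (θ * Complex.I)) := by
  rw [← Complex.exp_conj, inv_neg, ← Complex.exp_neg]
  simp

lemma arc_real {θ : ℝ} (h : 0 < Real.sin θ) :
    jinv (Complex.exp (θ * Complex.I)) = ((jinv (Complex.exp (θ * Complex.I))).re : ℂ) := by
  have him : 0 < (Complex.exp (θ * Complex.I)).im := by rwa [arc_im]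
  have := jinv_conj him
  rw [← arc_neg_inv, jinv_S him] at this
  exact (Complex.conj_eq_iff_re.1 this.symm).symm

lemma arc_symm {θ : ℝ} (h : 0 < Real.sin θ) :
    jinv (Complex.exp ((π - θ : ℝ) * Complex.I)) = jinv (Complex.exp (θ * Complex.I)) := by
  have him : 0 < (Complex.exp (θ * Complex.I)).im := by rwa [arc_im]
  rw [← jinv_S him]
  congr 1
  push_cast
  rw [sub_mul, Complex.exp_sub, Complex.exp_pi_mul_I, inv_neg]
  simp [div_eq_mul_inv]

lemma arc_sin_ge {θ : ℝ} (h : θ ∈ Set.Icc (π / 3) (2 * π / 3)) : √3 / 2 ≤ Real.sin θ := by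
  have hp := Real.pi_pos
  rcases le_total θ (π / 2) with h1 | h1
  · rw [← Real.sin_pi_div_three]
    exact Real.sin_le_sin_of_le_of_le_pi_div_two (by linarith) h1 h.1
  · rw [← Real.sin_pi_div_three, ← Real.sin_pi_sub θ]
    exact Real.sin_le_sin_of_le_of_le_pi_div_two (by linarith) (by linarith) (by linarith [h.2])

lemma arc_sin_gt {θ : ℝ} (h : θ ∈ Set.Icc (π / 3) (2 * π / 3)) : 0.86 < Real.sin θ := by
  refine lt_of_lt_of_le ?_ (arc_sin_ge h)
  have : (1.72 : ℝ) < √3 := by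
    rw [Real.lt_sqrt (by norm_num)]; norm_num
  linarith

lemma arc_sin_pos {θ : ℝ} (h : θ ∈ Set.Icc (π / 3) (2 * π / 3)) : 0 < Real.sin θ :=
  lt_trans (by norm_num) (arc_sin_gt h)

lemma qexp_norm (z : ℂ) : ‖qexp z‖ = Real.exp (-(2 * π * z.im)) := by
  rw [qexp, Complex.norm_exp]
  congr 1
  simp

lemma qexp_im (z : ℂ) : (qexp z).im = Real.exp (-(2 * π * z.im)) * Real.sin (2 * π * z.re) := by
  rw [qexp, Complex.exp_im]
  congr 2 <;> simp

lemma exp_bound : Real.exp (-(5.4 : ℝ)) ≤ 1 / 200 := by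
  have h1 : (2.718 : ℝ) ^ 5 ≤ Real.exp 5 := by
    have := Real.exp_one_gt_d9
    calc (2.718 : ℝ) ^ 5 ≤ (Real.exp 1) ^ 5 := by gcongr; linarith
      _ = Real.exp 5 := by rw [← Real.exp_nat_mul]; norm_num
  have h2 : (1.4 : ℝ) ≤ Real.exp 0.4 := by
    have := Real.add_one_le_exp (0.4 : ℝ); linarith
  have h3 : (200 : ℝ) ≤ Real.exp 5.4 := by
    calc (200 : ℝ) ≤ 2.718 ^ 5 * 1.4 := by norm_num
      _ ≤ Real.exp 5 * Real.exp 0.4 := by gcongr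
      _ = Real.exp 5.4 := by rw [← Real.exp_add]; norm_num
  rw [Real.exp_neg, one_div]
  gcongr

lemma arc_q {θ : ℝ} (h : θ ∈ Set.Ioo (π / 2) (2 * π / 3)) :
    ‖qexp (Complex.exp (θ * Complex.I))‖ ≤ 1 / 200 ∧
    (qexp (Complex.exp (θ * Complex.I))).im ≠ 0 := by
  have hp := Real.pi_pos
  have hp3 := Real.pi_gt_d2
  have hs := arc_sin_gt (θ := θ) ⟨by linarith [h.1], h.2.le⟩
  constructor
  · rw [qexp_norm, arc_im]
    refine le_trans (Real.exp_le_exp.2 ?_) exp_bound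
    nlinarith
  · rw [qexp_im, arc_im, arc_re]
    refine mul_ne_zero (Real.exp_pos _).ne' (ne_of_lt ?_)
    have hc : Real.cos θ < 0 := Real.cos_neg_of_pi_div_two_lt_of_lt h.1 (by linarith [h.2])
    have hc2 : -(1 / 2) < Real.cos θ := by
      have : Real.cos (2 * π / 3) < Real.cos θ :=
        Real.cos_lt_cos_of_nonneg_of_le_pi (by linarith [h.1]) (by linarith) h.2
      have e : Real.cos (2 * π / 3) = -(1 / 2) := by
        rw [show 2 * π / 3 = π - π / 3 by ring, Real.cos_pi_sub, Real.cos_pi_div_three]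
      linarith
    apply Real.sin_neg_of_neg_of_neg_pi_lt <;> nlinarith

lemma arc_ne {θ : ℝ} (h : θ ∈ Set.Ioo (π / 2) (2 * π / 3)) :
    jinv (Complex.exp (θ * Complex.I)) ≠ 0 ∧ jinv (Complex.exp (θ * Complex.I)) ≠ 1728 := by
  have hp := Real.pi_pos
  have him : 0 < (Complex.exp (θ * Complex.I)).im := by
    rw [arc_im]; exact arc_sin_pos ⟨by linarith [h.1], h.2.le⟩
  obtain ⟨h1, h2⟩ := arc_q h
  have h4 : Eis 4 (Complex.exp (θ * Complex.I)) ≠ 0 :=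
    Eis_ne (by norm_num) (by norm_num) (by decide) him
      (by rw [bernoulli_eq_bernoulli'_of_ne_one (by norm_num)]; norm_num) h1 h2
  have h6 : Eis 6 (Complex.exp (θ * Complex.I)) ≠ 0 := by
    refine Eis_ne (by norm_num) (by norm_num) (by decide) him ?_ h1 h2
    rw [show _root_.bernoulli 6 = 1 / 42 by decide +kernel]
    norm_num
  have hD := Disc_ne him
  refine ⟨div_ne_zero (pow_ne_zero _ h4) hD, fun h => ?_⟩
  rw [jinv, div_eq_iff hD] at h
  have := Disc_eq46 him
  apply pow_ne_zero 2 h6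
  linear_combination 1728 * this + h

lemma jinv_I : jinv Complex.I = 1728 := by
  have him : 0 < Complex.I.im := by simp
  have hD := Disc_ne him
  have h6 : Eis 6 Complex.I = 0 := by
    have := Eis_S (k := 6) (by norm_num) him
    have e : Complex.I ^ 6 = -1 := by
      rw [show 6 = 2 * 3 by norm_num, pow_mul, Complex.I_sq]; norm_num
    have e2 : (-Complex.I)⁻¹ = Complex.I := by simp
    rw [e, e2] at this
    have h2 : 2 * Eis 6 Complex.I = 0 := by linear_combination this
    simpa using h2
  have := Disc_eq46 him
  rw [jinv, div_eq_iff hD]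
  rw [h6] at this
  linear_combination (-1728) * this

lemma arc_start : jinv (Complex.exp ((π / 2 : ℝ) * Complex.I)) = 1728 := by
  rw [← jinv_I]
  congr 1
  push_cast
  exact Complex.exp_pi_div_two_mul_I

lemma exp_rho : Complex.exp ((2 * π / 3 : ℝ) * Complex.I) = -(1 / 2) + (√3 / 2 : ℝ) * Complex.I := by
  have h1 : Real.cos (2 * π / 3) = -(1 / 2) := by
    rw [show 2 * π / 3 = π - π / 3 by ring, Real.cos_pi_sub, Real.cos_pi_div_three]
  have h2 : Real.sin (2 * π / 3) = √3 / 2 := by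
    rw [show 2 * π / 3 = π - π / 3 by ring, Real.sin_pi_sub, Real.sin_pi_div_three]
  rw [Complex.exp_mul_I, ← Complex.ofReal_cos, ← Complex.ofReal_sin, h1, h2]
  push_cast; ring

lemma exp_rho' : Complex.exp ((π / 3 : ℝ) * Complex.I) = 1 / 2 + (√3 / 2 : ℝ) * Complex.I := by
  rw [Complex.exp_mul_I, ← Complex.ofReal_cos, ← Complex.ofReal_sin, Real.cos_pi_div_three,
    Real.sin_pi_div_three]
  push_cast; ring

lemma arc_end : jinv (Complex.exp ((2 * π / 3 : ℝ) * Complex.I)) = 0 := by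
  have him : 0 < (Complex.exp ((2 * π / 3 : ℝ) * Complex.I)).im := by
    rw [arc_im]; exact arc_sin_pos ⟨by linarith [Real.pi_pos], le_rfl⟩
  set z := Complex.exp ((2 * π / 3 : ℝ) * Complex.I) with hz
  have hz0 : z ≠ 0 := Complex.exp_ne_zero _
  have h3 : ((√3 : ℝ) : ℂ) ^ 2 = 3 := by
    rw [← Complex.ofReal_pow, Real.sq_sqrt (by norm_num)]; norm_num
  have hq : z ^ 2 + z + 1 = 0 := by
    rw [hz, exp_rho]; push_cast
    linear_combination (1 / 4) * Complex.I ^ 2 * h3 + (3 / 4) * Complex.I_sq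
  have e : (-z)⁻¹ = z + 1 := by
    rw [inv_eq_iff_eq_inv, eq_comm, inv_eq_iff_eq_inv, eq_comm]
    apply inv_eq_of_mul_eq_one_left
    linear_combination -hq
  have h4 : Eis 4 z = 0 := by
    have h := Eis_S (k := 4) (by norm_num) him
    rw [e, Eis_T (by norm_num) him] at h
    have h1 : (1 - z ^ 4) * Eis 4 z = 0 := by linear_combination h
    rcases mul_eq_zero.1 h1 with h2 | h2
    · exfalso
      have hz1 : z = 1 := by linear_combination (z - z ^ 2) * hq - h2
      rw [hz1] at him
      simp at him
    · exact h2
  simp [jinv, h4]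

lemma arc_cont : ContinuousOn (fun θ : ℝ => jinv (Complex.exp (θ * Complex.I)))
    (Set.Icc (π / 3) (2 * π / 3)) := by
  refine jinv_diff.continuousOn.comp (by fun_prop) fun θ h => ?_
  show 0 < (Complex.exp (θ * Complex.I)).im
  rw [arc_im]; exact arc_sin_pos h

/-- the real-valued function on the arc -/
def garc (θ : ℝ) : ℝ := (jinv (Complex.exp (θ * Complex.I))).re

lemma garc_cont : ContinuousOn garc (Set.Icc (π / 2) (2 * π / 3)) :=
  Complex.continuous_re.comp_continuousOn
    (arc_cont.mono (Set.Icc_subset_Icc_left (by linarith [Real.pi_pos])))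

lemma garc_eq {θ : ℝ} (h : θ ∈ Set.Icc (π / 2) (2 * π / 3)) :
    jinv (Complex.exp (θ * Complex.I)) = (garc θ : ℂ) :=
  arc_real (arc_sin_pos ⟨by linarith [Real.pi_pos, h.1], h.2⟩)

lemma garc_start : garc (π / 2) = 1728 := by rw [garc, arc_start]; simp

lemma garc_end : garc (2 * π / 3) = 0 := by rw [garc, arc_end]; simp

lemma garc_lt {θ : ℝ} (h : θ ∈ Set.Icc (π / 2) (2 * π / 3)) (hne : θ ≠ π / 2) :
    garc θ < 1728 := by
  by_contra! hc
  have hm : (1728 : ℝ) ∈ Set.Icc (garc (2 * π / 3)) (garc θ) := ⟨by rw [garc_end]; norm_num, hc⟩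
  obtain ⟨t, ht, ht2⟩ := intermediate_value_Icc' h.2
    (garc_cont.mono (Set.Icc_subset_Icc_left h.1)) hm
  have h1 : π / 2 < t := lt_of_lt_of_le (lt_of_le_of_ne h.1 hne.symm) ht.1
  rcases ht.2.eq_or_lt with h2 | h2
  · rw [h2, garc_end] at ht2; norm_num at ht2
  · apply (arc_ne ⟨h1, h2⟩).2
    rw [garc_eq ⟨h1.le, h2.le⟩, ht2]; norm_num

lemma garc_nonneg {θ : ℝ} (h : θ ∈ Set.Icc (π / 2) (2 * π / 3)) : 0 ≤ garc θ := by
  by_contra! hc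
  have hm : (0 : ℝ) ∈ Set.Icc (garc θ) (garc (π / 2)) := ⟨hc.le, by rw [garc_start]; norm_num⟩
  obtain ⟨t, ht, ht2⟩ := intermediate_value_Icc' h.1
    (garc_cont.mono (Set.Icc_subset_Icc_right h.2)) hm
  rcases ht.1.eq_or_lt with h1 | h1
  · rw [← h1, garc_start] at ht2; norm_num at ht2
  rcases (ht.2.trans h.2).eq_or_lt with h2 | h2
  · have : θ = 2 * π / 3 := le_antisymm h.2 (h2 ▸ ht.2)
    rw [this, garc_end] at hc
    exact lt_irrefl _ hc
  · apply (arc_ne ⟨h1, h2⟩).1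
    rw [garc_eq ⟨h1.le, h2.le⟩, ht2]; norm_num
lemma contour {f : ℂ → ℂ} (hf : DifferentiableOn ℂ f {z | 0 < z.im})
    (hp : ∀ z : ℂ, 0 < z.im → f (z + 1) = f z) :
    ∫ x in (0:ℝ)..1, f (x + Complex.I) =
      -∫ θ in (π / 3)..(2 * π / 3), f (Complex.exp (θ * Complex.I)) *
        (Complex.exp (θ * Complex.I) * Complex.I) := by
  have hsub : Metric.ball (2 * Complex.I) 2 ⊆ {z : ℂ | 0 < z.im} := by
    intro z hz
    have h1 := Complex.abs_im_le_norm (z - 2 * Complex.I)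
    rw [Metric.mem_ball, dist_eq_norm] at hz
    have h2 := (abs_lt.1 (h1.trans_lt hz)).1
    simp at h2
    simpa using h2
  have hball : ∀ z : ℂ, z.re ^ 2 + z.im ^ 2 < 4 * z.im → z ∈ Metric.ball (2 * Complex.I) 2 := by
    intro z hz
    rw [Metric.mem_ball, dist_eq_norm, Complex.norm_eq_sqrt_sq_add_sq, Real.sqrt_lt' (by norm_num)]
    simp
    nlinarith
  obtain ⟨F, hF⟩ := (hf.mono hsub).isExactOn_ball
  have hfc : ContinuousOn f (Metric.ball (2 * Complex.I) 2) := (hf.mono hsub).continuousOn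
  -- general FTC
  have key : ∀ (γ dγ : ℝ → ℂ) (a b : ℝ), a ≤ b → (∀ t, HasDerivAt γ (dγ t) t) → Continuous dγ →
      (∀ t ∈ Set.Icc a b, γ t ∈ Metric.ball (2 * Complex.I) 2) →
      ∫ t in a..b, f (γ t) * dγ t = F (γ b) - F (γ a) := by
    intro γ dγ a b hab hd hc hm
    apply intervalIntegral.integral_eq_sub_of_hasDerivAt (f := fun t => F (γ t))
    · intro t ht
      rw [Set.uIcc_of_le hab] at ht
      exact (hF _ (hm t ht)).comp_of_eq t (hd t) rfl
    · apply ContinuousOn.intervalIntegrable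
      rw [Set.uIcc_of_le hab]
      have hγ : Continuous γ := continuous_iff_continuousAt.2 fun t => (hd t).continuousAt
      exact (hfc.comp hγ.continuousOn hm).mul hc.continuousOn
  have h3 : √3 ^ 2 = 3 := Real.sq_sqrt (by norm_num)
  have h30 : 1.72 < √3 := by
    rw [Real.lt_sqrt (by norm_num)]; norm_num
  have h31 : √3 < 1.74 := by
    rw [Real.sqrt_lt' (by norm_num)]; norm_num
  have hI1 : ∫ x in (0:ℝ)..1, f (x + Complex.I) = ∫ x in (-(1/2):ℝ)..(1/2), f (x + Complex.I) := by
    have hper : Function.Periodic (fun x : ℝ => f (x + Complex.I)) 1 := by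
      intro x
      have := hp (x + Complex.I) (by simp)
      simp only [← this]
      congr 1
      push_cast; ring
    have := hper.intervalIntegral_add_eq 0 (-(1/2))
    norm_num at this ⊢
    exact this
  have hA := key (fun t => (t : ℂ) + Complex.I) (fun _ => 1) (-(1/2)) (1/2) (by norm_num)
    (fun t => (Complex.ofRealCLM.hasDerivAt (x := t)).add_const _) continuous_const
    (fun t ht => hball _ (by simp; nlinarith [ht.1, ht.2]))
  have hder : ∀ (c : ℂ) (t : ℝ), HasDerivAt (fun t : ℝ => c + (t : ℂ) * Complex.I) Complex.I t := by
    intro c t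
    have := ((Complex.ofRealCLM.hasDerivAt (x := t)).mul_const Complex.I).const_add c
    simpa using this
  have hB := key (fun t => -(1/2) + (t : ℂ) * Complex.I) (fun _ => Complex.I) (√3 / 2) 1
    (by linarith) (hder _) continuous_const
    (fun t ht => hball _ (by simp; nlinarith [ht.1, ht.2]))
  have hC := key (fun t => 1/2 + (t : ℂ) * Complex.I) (fun _ => Complex.I) (√3 / 2) 1
    (by linarith) (hder _) continuous_const
    (fun t ht => hball _ (by simp; nlinarith [ht.1, ht.2]))
  have hBC : ∫ t in (√3 / 2)..1, f (-(1/2) + (t : ℂ) * Complex.I) * Complex.I =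
      ∫ t in (√3 / 2)..1, f (1/2 + (t : ℂ) * Complex.I) * Complex.I := by
    apply intervalIntegral.integral_congr
    intro t ht
    rw [Set.uIcc_of_le (by linarith)] at ht
    have ht0 : 0 < t := by linarith [ht.1]
    have := hp (-(1/2) + (t : ℂ) * Complex.I) (by simpa using ht0)
    simp only [← this]
    congr 2
    ring
  have hD := key (fun θ => Complex.exp (θ * Complex.I))
    (fun θ => Complex.exp (θ * Complex.I) * Complex.I) (π / 3) (2 * π / 3)
    (by linarith [Real.pi_pos])
    (fun t => by
      have := ((Complex.ofRealCLM.hasDerivAt (x := t)).mul_const Complex.I).cexp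
      simpa using this) (by fun_prop)
    (fun t ht => hball _ (by
      rw [arc_im, arc_re]
      have := arc_sin_gt ht
      nlinarith [Real.sin_sq_add_cos_sq t]))
  simp only [exp_rho, exp_rho'] at hD
  rw [hI1, hD]
  simp only [mul_one] at hA
  rw [hA]
  rw [hBC, hC] at hB
  push_cast at hB ⊢
  simp only [one_mul] at hB
  linear_combination hB

lemma cj_eq (n : ℕ) :
    cj n 0 = 2 * ∫ θ in (π / 2)..(2 * π / 3), jinv (Complex.exp (θ * Complex.I)) ^ n * Real.sin θ := by
  have hp := Real.pi_pos
  have h0 : cj n 0 = ∫ x in (0:ℝ)..1, (fun z => jinv z ^ n) (x + Complex.I) := by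
    simp [cj, qCoeff]
  rw [h0, contour (f := fun z => jinv z ^ n) (jinv_diff.pow n) (fun z hz => by simp only [jinv_T hz])]
  set g : ℝ → ℂ := fun θ => jinv (Complex.exp (θ * Complex.I)) ^ n *
        (Complex.exp (θ * Complex.I) * Complex.I) with hg
  have hgc : ContinuousOn g (Set.Icc (π / 3) (2 * π / 3)) :=
    (arc_cont.pow n).mul (by fun_prop)
  have hi1 : IntervalIntegrable g volume (π / 3) (π / 2) := by
    apply ContinuousOn.intervalIntegrable_of_Icc (by linarith)
    exact hgc.mono (Set.Icc_subset_Icc_right (by linarith))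
  have hi2 : IntervalIntegrable g volume (π / 2) (2 * π / 3) := by
    apply ContinuousOn.intervalIntegrable_of_Icc (by linarith)
    exact hgc.mono (Set.Icc_subset_Icc_left (by linarith))
  have hrefl : ∫ θ in (π / 3)..(π / 2), g θ = ∫ θ in (π / 2)..(2 * π / 3), g (π - θ) := by
    rw [intervalIntegral.integral_comp_sub_left g π]
    congr 1 <;> ring
  have hi3 : IntervalIntegrable (fun θ => g (π - θ)) volume (π / 2) (2 * π / 3) := by
    apply ContinuousOn.intervalIntegrable_of_Icc (by linarith)
    refine hgc.comp (by fun_prop) fun t ht => ⟨by linarith [ht.2], by linarith [ht.1]⟩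
  change -∫ θ in (π / 3)..(2 * π / 3), g θ = _
  rw [← intervalIntegral.integral_add_adjacent_intervals hi1 hi2, hrefl,
    ← intervalIntegral.integral_add hi3 hi2, ← intervalIntegral.integral_neg,
    ← intervalIntegral.integral_const_mul]
  apply intervalIntegral.integral_congr
  intro t ht
  rw [Set.uIcc_of_le (by linarith)] at ht
  have hs := arc_sin_pos (θ := t) ⟨by linarith [ht.1], ht.2⟩
  simp only [hg]
  rw [arc_symm hs]
  have e1 : Complex.exp (((π - t : ℝ) : ℂ) * Complex.I) = -(Real.cos t) + Real.sin t * Complex.I := by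
    rw [Complex.exp_mul_I, ← Complex.ofReal_cos, ← Complex.ofReal_sin, Real.cos_pi_sub,
      Real.sin_pi_sub]
    push_cast; ring
  have e2 : Complex.exp ((t : ℂ) * Complex.I) * Complex.I =
      (Real.cos t + Real.sin t * Complex.I) * Complex.I := by
    rw [Complex.exp_mul_I, ← Complex.ofReal_cos, ← Complex.ofReal_sin]
  rw [e1, e2]
  linear_combination (-2) * jinv (Complex.exp (t * Complex.I)) ^ n * Real.sin t * Complex.I_sq
lemma Acoef_eq (n : ℕ) : Acoef n =
    ((1 / (2 * π) * ∫ θ in Set.Icc (π / 2) (2 * π / 3), garc θ ^ n : ℝ) : ℂ) := by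
  have hp := Real.pi_pos
  rw [Acoef, integral_Icc_eq_integral_Ioc, ← intervalIntegral.integral_of_le (by linarith)]
  push_cast
  rw [← intervalIntegral.integral_ofReal]
  congr 1
  apply intervalIntegral.integral_congr
  intro t ht
  rw [Set.uIcc_of_le (by linarith)] at ht
  simp only [garc_eq ht]
  push_cast; rfl

lemma Bcoef_eq (n : ℕ) : -Bcoef n =
    ((2 * ∫ θ in Set.Icc (π / 2) (2 * π / 3), garc θ ^ n • Real.sin θ : ℝ) : ℂ) := by
  have hp := Real.pi_pos
  rw [Bcoef, neg_neg, cj_eq, integral_Icc_eq_integral_Ioc,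
    ← intervalIntegral.integral_of_le (by linarith)]
  push_cast
  rw [← intervalIntegral.integral_ofReal]
  congr 1
  apply intervalIntegral.integral_congr
  intro t ht
  rw [Set.uIcc_of_le (by linarith)] at ht
  simp only [garc_eq ht, smul_eq_mul]
  push_cast; rfl

/-- With `A_n = (1/2π)∫_{π/2}^{2π/3} j(e^{iθ})^n dθ` and
`B_n = -c_n(0)`, we have `A_n/(-B_n) → 1/(4π)` as `n → ∞`. -/
theorem ratio_tendsto_one_over_four_pi :
    Tendsto (fun n : ℕ => Acoef n / (- Bcoef n)) atTop
      (𝓝 (1 / (4 * (Real.pi : ℂ)))) := by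
  have hp := Real.pi_pos
  have hlt : π / 2 < 2 * π / 3 := by linarith
  have h := tendsto_setIntegral_pow_smul_of_unique_maximum_of_isCompact_of_continuousOn
    (μ := volume) (s := Set.Icc (π / 2) (2 * π / 3)) (x₀ := π / 2) (c := garc) (g := Real.sin)
    isCompact_Icc garc_cont (fun y hy hne => by rw [garc_start]; exact garc_lt hy hne)
    (fun x hx => garc_nonneg hx) (by rw [garc_start]; norm_num)
    (by rw [interior_Icc, closure_Ioo hlt.ne]; exact ⟨le_rfl, hlt.le⟩)
    Real.continuous_sin.continuousOn
  rw [Real.sin_pi_div_two] at h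
  have h2 := (h.inv₀ one_ne_zero).const_mul (1 / (4 * π))
  have h3 := (Complex.continuous_ofReal.tendsto _).comp h2
  refine Tendsto.congr (fun n => ?_) (by simpa using h3)
  rw [Acoef_eq, Bcoef_eq, ← Complex.ofReal_div]
  simp only [Function.comp]
  congr 1
  simp only [smul_eq_mul]
  ring
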